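/- Let the $\mathcal P$-adic partial sums $S_N(x) = \sum_{\bar n < \tilde N} a_{\bar n} \chi^{\mathcal P}_{\bar n}(x)$ of a multiple generalized Haar series converge to $0$ almost everywhere on $[0,1]^d$, with $\sup_{i,j} p^j_i < \infty$, and suppose there exists a sequence $\{h_m\}$ satisfying conditions (h1)–(h3) on $[0,1]^d$ such that $\lim_{m \to \infty} \int_{\{x : \sup_N |S_N(x)| > h_m(x)\}} h_m(x)\,dx = 0$. Then $a_{\bar n} = 0$ for all $\bar n \in \mathbb Z_+^d$. -/

import Mathlib

open MeasureTheory Filter Topology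

noncomputable section

/-- `mseq p k = ∏_{i<k} p i`, i.e. `m_k = p_1 ⋯ p_k` (Lean indexes `p` from `0`). -/
def mseq (p : ℕ → ℕ) (k : ℕ) : ℕ := ∏ i ∈ Finset.range k, p i

/-- `pdigit p x j` is the `(j+1)`-st digit `x_{j+1}` of the `P`-adic expansion
`x = ∑_t x_t/m_t`, `0 ≤ x_t ≤ p_t - 1` (for `P`-rational points this floor-based digit
extraction yields exactly the finite expansion, as chosen in the paper). -/
def pdigit (p : ℕ → ℕ) (x : ℝ) (j : ℕ) : ℕ :=
  (⌊x * (mseq p (j + 1) : ℝ)⌋ % (p j : ℤ)).toNat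

/-- `e^{2πit}`. -/
def eTwoPi (t : ℝ) : ℂ := Complex.exp (2 * (Real.pi : ℂ) * Complex.I * (t : ℂ))

/-- The Price function `ψ_k(x) = exp(2πi ∑_j α_j x_j / p_j)`, where
`k = ∑_j α_j m_{j-1}` with digits `0 ≤ α_j ≤ p_j - 1` (so `α_{j+1} = (k / m_j) mod p_{j+1}`
in Lean's `0`-based indexing; digits with index `> k` vanish, so the cut-off below is
harmless). -/
def price (p : ℕ → ℕ) (k : ℕ) (x : ℝ) : ℂ :=
  eTwoPi (∑ j ∈ Finset.range (k + 1),
    (((k / mseq p j) % p j : ℕ) : ℝ) * (pdigit p x j : ℝ) / (p j : ℝ))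

/-- The rank of the generalized Haar function `χ_n`, i.e. the unique `k` with
`m_k ≤ n < m_{k+1}` (and `0` for `n = 0`). -/
def hrank (p : ℕ → ℕ) (n : ℕ) : ℕ := Nat.findGreatest (fun k => mseq p k ≤ n) n

/-- The generalized Haar function `χ_n`: `χ_0 ≡ 1`, and for
`n = m_k + r(p_{k+1} - 1) + s - 1` with `0 ≤ r ≤ m_k - 1`, `1 ≤ s ≤ p_{k+1} - 1`,
`χ_n(x) = √(m_k) · e^{2πi x_{k+1} s / p_{k+1}}` for `x ∈ [r/m_k, (r+1)/m_k)` and `0`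
otherwise. -/
def ghaar (p : ℕ → ℕ) (n : ℕ) (x : ℝ) : ℂ :=
  if n = 0 then 1
  else
    let k := hrank p n
    let r := (n - mseq p k) / (p k - 1)
    let s := (n - mseq p k) % (p k - 1) + 1
    if (r : ℝ) / (mseq p k : ℝ) ≤ x ∧ x < ((r : ℝ) + 1) / (mseq p k : ℝ) then
      (Real.sqrt (mseq p k) : ℂ) * eTwoPi ((pdigit p x k : ℝ) * (s : ℝ) / (p k : ℝ))
    else 0

/-- The multiple generalized Haar function `χ^𝒫_n(x) = χ¹_{n₁}(x₁) ⋯ χᵈ_{n_d}(x_d)`. -/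
def ghaarD {d : ℕ} (p : Fin d → ℕ → ℕ) (n : Fin d → ℕ) (x : Fin d → ℝ) : ℂ :=
  ∏ j, ghaar (p j) (n j) (x j)

/-- The multiple Price function `ψ^𝒫_n(x) = ψ¹_{n₁}(x₁) ⋯ ψᵈ_{n_d}(x_d)`. -/
def priceD {d : ℕ} (p : Fin d → ℕ → ℕ) (n : Fin d → ℕ) (x : Fin d → ℝ) : ℂ :=
  ∏ j, price (p j) (n j) (x j)

/-- The `𝒫`-adic partial sum `∑_{n̄ < Ñ} a_{n̄} χ^𝒫_{n̄}(x)`, `Ñ = (N,…,N)`, where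
`n̄ < Ñ` means `n_j < mʲ_N` for all `j`. -/
def ghaarSum {d : ℕ} (p : Fin d → ℕ → ℕ) (a : (Fin d → ℕ) → ℂ) (N : ℕ)
    (x : Fin d → ℝ) : ℂ :=
  ∑ n ∈ Fintype.piFinset (fun j => Finset.range (mseq (p j) N)), a n * ghaarD p n x

/-- The `𝒫`-adic partial sum `∑_{n̄ < Ñ} b_{n̄} ψ^𝒫_{n̄}(x)`. -/
def priceSum {d : ℕ} (p : Fin d → ℕ → ℕ) (b : (Fin d → ℕ) → ℂ) (N : ℕ)
    (x : Fin d → ℝ) : ℂ :=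
  ∑ n ∈ Fintype.piFinset (fun j => Finset.range (mseq (p j) N)), b n * priceD p n x

/-- The `𝒫`-adic parallelepiped of rank `k` with corner index `n`. -/
def cell {d : ℕ} (p : Fin d → ℕ → ℕ) (k : ℕ) (n : Fin d → ℤ) : Set (Fin d → ℝ) :=
  Set.univ.pi fun j =>
    Set.Icc ((n j : ℝ) / (mseq (p j) k : ℝ)) (((n j : ℝ) + 1) / (mseq (p j) k : ℝ))

/-- `Λᵈ`, the collection of all `𝒫`-adic parallelepipeds. -/
def Lambda {d : ℕ} (p : Fin d → ℕ → ℕ) : Set (Set (Fin d → ℝ)) :=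
  {I | ∃ k n, I = cell p k n}

/-- `Ψ` is additive on the `𝒫`-adic parallelepipeds. -/
def IsAdditive {d : ℕ} (p : Fin d → ℕ → ℕ) (Ψ : Set (Fin d → ℝ) → ℂ) : Prop :=
  ∀ (I : Set (Fin d → ℝ)) (s : ℕ) (J : Fin s → Set (Fin d → ℝ)),
    I ∈ Lambda p → (∀ i, J i ∈ Lambda p) →
    (∀ i j, i ≠ j → Disjoint (interior (J i)) (interior (J j))) →
    (⋃ i, J i) = I → Ψ I = ∑ i, Ψ (J i)

/-- Truncation of `f` by the function `lam`: `[f(x)]_{lam(x)}`. -/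
def trunc {α : Type*} (f : α → ℂ) (lam : α → ℝ) (x : α) : ℂ :=
  if ‖f x‖ ≤ lam x then f x else 0

/-- Conditions (h1)–(h3) on the sequence of functions `h m : I₀ → ℝ`. -/
def HConds {d : ℕ} (p : Fin d → ℕ → ℕ) (I0 : Set (Fin d → ℝ))
    (h : ℕ → (Fin d → ℝ) → ℝ) : Prop :=
  (∀ x ∈ I0, (∀ m, 0 ≤ h m x) ∧ (Monotone fun m => h m x) ∧
      Tendsto (fun m => h m x) atTop atTop) ∧
  ∃ C > (0 : ℝ), ∃ ε > (0 : ℝ), ∀ m : ℕ, ∃ (s : ℕ) (J : Fin s → Set (Fin d → ℝ)),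
    (∀ i, J i ∈ Lambda p) ∧
    (∀ i j, i ≠ j → Disjoint (interior (J i)) (interior (J j))) ∧
    (⋃ i, J i) = I0 ∧
    (∀ i, ∀ x ∈ J i, ∀ y ∈ J i, h m x ≤ C * h m y) ∧
    (∀ i, ε ≤ ∫ x in J i, h m x)

/-- `‖χ^𝒫_{n̄}‖_∞ = ∏_j √(mʲ_{rank(n_j)})`, the sup-norm of the multiple generalized Haar
function `χ^𝒫_{n̄}`. -/
def ghaarNormD {d : ℕ} (p : Fin d → ℕ → ℕ) (n : Fin d → ℕ) : ℝ :=
  ∏ j, Real.sqrt (mseq (p j) (hrank (p j) (n j)))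

section CellMartingale

/-- A saturated set is the union of the fibres it contains. -/
lemma eq_iUnion_fibre {X ι : Type*} {φ : X → ι} {G : Set X}
    (hG : ∀ x y, φ x = φ y → x ∈ G → y ∈ G) :
    G = ⋃ i : φ '' G, φ ⁻¹' {(i : ι)} := by
  ext y
  simp only [Set.mem_iUnion, Set.mem_preimage, Set.mem_singleton_iff]
  constructor
  · exact fun hy => ⟨⟨φ y, y, hy, rfl⟩, rfl⟩
  · rintro ⟨⟨_, x, hx, rfl⟩, h⟩
    exact hG x y h.symm hx

lemma pairwise_disjoint_fibre {X ι : Type*} (φ : X → ι) (A : Set ι) :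
    Pairwise (Function.onFun Disjoint fun i : A => φ ⁻¹' {(i : ι)}) := by
  intro i j hij
  refine Disjoint.preimage _ ?_
  simpa [Subtype.ext_iff] using hij

variable {X ι : Type*} [MeasurableSpace X] [MeasurableSpace ι]

/-- `S` is a martingale for the filtration generated by the refining countable partitions into
fibres ("cells") of `φ n`, all of which have finite measure. -/
structure IsCellMartingale (μ : Measure X) (φ : ℕ → X → ι) (S : ℕ → X → ℂ) : Prop where
  measurable : ∀ n, Measurable (φ n)
  measure_ne_top : ∀ n i, μ (φ n ⁻¹' {i}) ≠ ⊤
  nested : ∀ n x y, φ (n + 1) x = φ (n + 1) y → φ n x = φ n y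
  const : ∀ n x y, φ n x = φ n y → S n x = S n y
  integrableOn : ∀ n k i, IntegrableOn (S n) (φ k ⁻¹' {i}) μ
  setIntegral_succ : ∀ n i,
    ∫ x in φ n ⁻¹' {i}, S (n + 1) x ∂μ = ∫ x in φ n ⁻¹' {i}, S n x ∂μ

variable {μ : Measure X} {φ : ℕ → X → ι} {S : ℕ → X → ℂ}

lemma IsCellMartingale.nested_le (hS : IsCellMartingale μ φ S) {k n : ℕ} (hkn : k ≤ n) {x y : X}
    (h : φ n x = φ n y) : φ k x = φ k y := by
  induction n, hkn using Nat.le_induction with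
  | base => exact h
  | succ n _ ih => exact ih (hS.nested n x y h)

variable [MeasurableSingletonClass ι]

lemma IsCellMartingale.norm_le_of_measure_lt (hS : IsCellMartingale μ φ S) {E : Set X} {L : ℝ} {n : ℕ} {x : X}
    (hE : ∀ y, φ n y = φ n x → y ∉ E → ‖S n y‖ ≤ L)
    (h : μ.restrict E (φ n ⁻¹' {φ n x}) < μ (φ n ⁻¹' {φ n x})) : ‖S n x‖ ≤ L := by
  rw [Measure.restrict_apply (hS.measurable n (measurableSet_singleton _))] at h
  obtain ⟨y, hy, hyE⟩ : ∃ y, φ n y = φ n x ∧ y ∉ E := by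
    by_contra! hc
    rw [Set.inter_eq_left.mpr (show φ n ⁻¹' {φ n x} ⊆ E from fun y hy => hc y hy)] at h
    exact lt_irrefl _ h
  rw [← hS.const n y x hy]
  exact hE y hy hyE

variable [Countable ι]

lemma measurableSet_of_saturated {φ : X → ι} (hφ : Measurable φ) {G : Set X}
    (hG : ∀ x y, φ x = φ y → x ∈ G → y ∈ G) : MeasurableSet G := by
  rw [eq_iUnion_fibre hG]
  exact MeasurableSet.iUnion fun i => hφ (measurableSet_singleton _)

lemma measurable_of_eq_on_fibres {Y : Type*} [MeasurableSpace Y] {φ : X → ι} (hφ : Measurable φ)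
    {f : X → Y} (hf : ∀ x y, φ x = φ y → f x = f y) : Measurable f := fun s _ =>
  measurableSet_of_saturated hφ fun x y hxy hx => by
    rwa [Set.mem_preimage, ← hf x y hxy]

lemma setIntegral_congr_of_fibres {μ : Measure X} {φ : X → ι} (hφ : Measurable φ)
    {f g : X → ℂ} {G : Set X} (hG : ∀ x y, φ x = φ y → x ∈ G → y ∈ G)
    (hf : IntegrableOn f G μ) (hg : IntegrableOn g G μ)
    (h : ∀ x ∈ G, ∫ y in φ ⁻¹' {φ x}, f y ∂μ = ∫ y in φ ⁻¹' {φ x}, g y ∂μ) :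
    ∫ y in G, f y ∂μ = ∫ y in G, g y ∂μ := by
  have hU := eq_iUnion_fibre hG
  have hm : ∀ i : φ '' G, MeasurableSet (φ ⁻¹' {(i : ι)}) := fun i =>
    hφ (measurableSet_singleton _)
  rw [hU] at hf hg ⊢
  rw [integral_iUnion hm (pairwise_disjoint_fibre φ _) hf,
    integral_iUnion hm (pairwise_disjoint_fibre φ _) hg]
  refine tsum_congr ?_
  rintro ⟨_, x, hx, rfl⟩
  exact h x hx

lemma measure_le_of_fibres {μ₁ μ₂ : Measure X} {φ : X → ι} (hφ : Measurable φ)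
    {G : Set X} (hG : ∀ x y, φ x = φ y → x ∈ G → y ∈ G)
    (h : ∀ x ∈ G, μ₁ (φ ⁻¹' {φ x}) ≤ μ₂ (φ ⁻¹' {φ x})) : μ₁ G ≤ μ₂ G := by
  have hm : ∀ i : φ '' G, MeasurableSet (φ ⁻¹' {(i : ι)}) := fun i =>
    hφ (measurableSet_singleton _)
  rw [eq_iUnion_fibre hG, measure_iUnion (pairwise_disjoint_fibre φ _) hm,
    measure_iUnion (pairwise_disjoint_fibre φ _) hm]
  refine ENNReal.tsum_le_tsum ?_
  rintro ⟨_, x, hx, rfl⟩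
  exact h x hx

namespace IsCellMartingale

lemma setIntegral_eq (hS : IsCellMartingale μ φ S) {k n : ℕ} (hkn : k ≤ n) (i : ι) :
    ∫ x in φ k ⁻¹' {i}, S n x ∂μ = ∫ x in φ k ⁻¹' {i}, S k x ∂μ := by
  induction n, hkn using Nat.le_induction with
  | base => rfl
  | succ n hkn ih =>
    rw [← ih]
    refine setIntegral_congr_of_fibres (hS.measurable n) ?_ (hS.integrableOn _ _ _)
      (hS.integrableOn _ _ _) fun x _ => hS.setIntegral_succ n _
    intro x y hxy hx
    exact (hS.nested_le hkn hxy).symm.trans hx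

/-- A cell martingale tending to `0` a.e. on a cell `Q` and bounded by `L` outside of a small set
`E` has a small mean over `Q`: stop it on the maximal cells in which `E` is relatively large. -/
theorem norm_setIntegral_le (hS : IsCellMartingale μ φ S) {θ : ℝ} (hθ : 0 < θ)
    (hreg : ∀ n x, ENNReal.ofReal θ * μ (φ n ⁻¹' {φ n x}) < μ (φ (n + 1) ⁻¹' {φ (n + 1) x}))
    {K : ℕ} {i : ι} {E : Set X} {L : ℝ} (hL0 : 0 ≤ L)
    (hL : ∀ x, φ K x = i → x ∉ E → ∀ n, ‖S n x‖ ≤ L)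
    (hE : μ.restrict E (φ K ⁻¹' {i}) ≤ ENNReal.ofReal θ * μ (φ K ⁻¹' {i}))
    (hlim : ∀ᵐ x ∂(μ.restrict (φ K ⁻¹' {i})), Tendsto (fun n => S n x) atTop (𝓝 0)) :
    ‖∫ x in φ K ⁻¹' {i}, S K x ∂μ‖ ≤ L / θ * (μ.restrict E).real (φ K ⁻¹' {i}) := by
  set Q := φ K ⁻¹' {i} with hQ
  set good : ℕ → X → Prop := fun n x =>
    μ.restrict E (φ n ⁻¹' {φ n x}) ≤ ENNReal.ofReal θ * μ (φ n ⁻¹' {φ n x}) with hgood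
  set G : ℕ → Set X := fun l => {x | x ∈ Q ∧ ∀ k ≤ l, good (K + k) x} with hGdef
  have hsat : ∀ l x y, φ (K + l) x = φ (K + l) y → x ∈ G l → y ∈ G l := by
    rintro l x y hxy ⟨hx, hg⟩
    refine ⟨(hS.nested_le (Nat.le_add_right K l) hxy).symm.trans hx, fun k hk => ?_⟩
    have := hg k hk
    simp only [hgood] at this ⊢
    rwa [← hS.nested_le (Nat.add_le_add_left hk K) hxy]
  have hmG : ∀ l, MeasurableSet (G l) := fun l =>
    measurableSet_of_saturated (hS.measurable _) (hsat l)
  have hmQ : MeasurableSet Q := hS.measurable K (measurableSet_singleton _)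
  have hGQ : ∀ l, G l ⊆ Q := fun l x hx => hx.1
  have hGG : ∀ l, G (l + 1) ⊆ G l := fun l x hx => ⟨hx.1, fun k hk => hx.2 k (by omega)⟩
  have hQtop : μ Q ≠ ⊤ := hS.measure_ne_top K i
  have hQtopE : μ.restrict E Q ≠ ⊤ :=
    ((Measure.restrict_apply_le _ _).trans_lt hQtop.lt_top).ne
  have hint : ∀ n, IntegrableOn (S n) Q μ := fun n => hS.integrableOn n K i
  have hL' : ∀ {n x}, x ∈ Q → K ≤ n → ∀ y, φ n y = φ n x → y ∉ E → ‖S n y‖ ≤ L :=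
    fun {n x} hx hn y hy hyE => hL y ((hS.nested_le hn hy).trans hx) hyE n
  have hcell : ∀ n x, φ (n + 1) ⁻¹' {φ (n + 1) x} ⊆ φ n ⁻¹' {φ n x} :=
    fun n x y hy => hS.nested n y x hy
  have hb : ∀ l x, x ∈ G l → ‖S (K + l) x‖ ≤ L := fun l x hx =>
    hS.norm_le_of_measure_lt (hL' hx.1 (Nat.le_add_right K l))
      ((hx.2 l le_rfl).trans_lt ((hreg _ _).trans_le (measure_mono (hcell _ _))))
  have hb' : ∀ l x, x ∈ G l → ‖S (K + l + 1) x‖ ≤ L := fun l x hx =>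
    hS.norm_le_of_measure_lt (hL' hx.1 (by omega))
      (((measure_mono (hcell _ _)).trans (hx.2 l le_rfl)).trans_lt (hreg _ _))
  have hG0 : G 0 = Q := by
    refine Set.Subset.antisymm (hGQ 0) fun x hx => ⟨hx, fun k hk => ?_⟩
    obtain rfl : k = 0 := by omega
    have hxi : φ K x = i := hx
    simp only [hgood, add_zero, hxi]
    exact hE
  have hbad : ∀ l, μ.real (G l \ G (l + 1)) ≤ θ⁻¹ * (μ.restrict E).real (G l \ G (l + 1)) := by
    intro l
    have hle : (ENNReal.ofReal θ • μ) (G l \ G (l + 1)) ≤ μ.restrict E (G l \ G (l + 1)) := by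
      refine measure_le_of_fibres (hS.measurable (K + (l + 1))) ?_ ?_
      · rintro x y hxy ⟨hx, hx'⟩
        exact ⟨hsat l x y (hS.nested _ _ _ hxy) hx, fun hy => hx' (hsat _ y x hxy.symm hy)⟩
      · rintro x ⟨hx, hx'⟩
        have : ¬ good (K + (l + 1)) x := fun hg => hx' ⟨hx.1, fun k hk => by
          rcases Nat.lt_or_ge k (l + 1) with h | h
          · exact hx.2 k (by omega)
          · obtain rfl : k = l + 1 := by omega
            exact hg⟩
        exact (not_le.mp this).le
    have hfin : μ.restrict E (G l \ G (l + 1)) ≠ ⊤ :=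
      ne_top_of_le_ne_top hQtopE (measure_mono fun x hx => hGQ l hx.1)
    have := ENNReal.toReal_mono hfin hle
    rw [Measure.smul_apply, smul_eq_mul, ENNReal.toReal_mul, ENNReal.toReal_ofReal hθ.le] at this
    rw [le_inv_mul_iff₀ hθ]
    exact this
  have key : ∀ l, ‖∫ x in Q, S K x ∂μ‖ ≤
      ‖∫ x in G l, S (K + l) x ∂μ‖ + L / θ * (μ.restrict E).real (Q \ G l) := by
    intro l
    induction l with
    | zero => simp [hG0]
    | succ l ih =>
      have h1 : ∫ x in G l, S (K + l) x ∂μ = ∫ x in G l, S (K + l + 1) x ∂μ :=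
        (setIntegral_congr_of_fibres (hS.measurable _) (hsat l) ((hint _).mono_set (hGQ l))
          ((hint _).mono_set (hGQ l)) fun x _ => hS.setIntegral_succ _ _).symm
      have h2 : ∫ x in G l, S (K + l + 1) x ∂μ = ∫ x in G (l + 1), S (K + l + 1) x ∂μ +
          ∫ x in G l \ G (l + 1), S (K + l + 1) x ∂μ := by
        rw [← setIntegral_union Set.disjoint_sdiff_right ((hmG l).diff (hmG _))
          ((hint _).mono_set (hGQ _)) ((hint _).mono_set fun x hx => hGQ l hx.1),
          Set.union_sdiff_cancel (hGG l)]
      have h3 : ‖∫ x in G l \ G (l + 1), S (K + l + 1) x ∂μ‖ ≤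
          L * μ.real (G l \ G (l + 1)) :=
        norm_setIntegral_le_of_norm_le_const
          ((measure_mono fun x hx => hGQ l hx.1).trans_lt hQtop.lt_top)
          fun x hx => hb' l x hx.1
      have h4 : (μ.restrict E).real (Q \ G (l + 1)) = (μ.restrict E).real (Q \ G l) +
          (μ.restrict E).real (G l \ G (l + 1)) := by
        rw [← measureReal_union (Set.disjoint_left.mpr fun x hx hx' => hx.2 hx'.1)
          ((hmG l).diff (hmG _)) (ne_top_of_le_ne_top hQtopE (measure_mono fun x hx => hx.1))
          (ne_top_of_le_ne_top hQtopE (measure_mono fun x hx => hGQ l hx.1))]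
        congr 1
        ext x
        have := @hGG l x
        have := @hGQ l x
        simp only [Set.mem_union, Set.mem_sdiff]
        tauto
      have h5 : L * μ.real (G l \ G (l + 1)) ≤
          L / θ * (μ.restrict E).real (G l \ G (l + 1)) := by
        rw [div_eq_mul_inv, mul_assoc]
        exact mul_le_mul_of_nonneg_left (hbad l) hL0
      have h6 : ‖∫ x in G l, S (K + l) x ∂μ‖ ≤ ‖∫ x in G (l + 1), S (K + l + 1) x ∂μ‖ +
          ‖∫ x in G l \ G (l + 1), S (K + l + 1) x ∂μ‖ := by
        rw [h1, h2]
        exact norm_add_le _ _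
      rw [h4, mul_add]
      change _ ≤ ‖∫ x in G (l + 1), S (K + l + 1) x ∂μ‖ + _
      linarith
  have hlim' : Tendsto (fun l => ∫ x in G l, S (K + l) x ∂μ) atTop (𝓝 0) := by
    have heq : ∀ l, ∫ x in G l, S (K + l) x ∂μ =
        ∫ x in Q, (G l).indicator (S (K + l)) x ∂μ := fun l => by
      rw [setIntegral_indicator (hmG l), Set.inter_eq_right.mpr (hGQ l)]
    simp_rw [heq]
    rw [← integral_zero X ℂ (μ := μ.restrict Q)]
    have : IsFiniteMeasure (μ.restrict Q) := ⟨by simpa using hQtop.lt_top⟩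
    refine tendsto_integral_of_dominated_convergence (fun _ => L)
      (fun l => ((hint _).aestronglyMeasurable.indicator (hmG l))) (integrable_const _)
      (fun l => ?_) ?_
    · refine Eventually.of_forall fun x => ?_
      by_cases hx : x ∈ G l
      · simpa [hx] using hb l x hx
      · simpa [hx] using hL0
    · filter_upwards [hlim] with x hx
      refine squeeze_zero_norm (fun l => norm_indicator_le_norm_self _ _) ?_
      have := (hx.comp (tendsto_add_atTop_nat K)).norm
      simpa [Function.comp_def, add_comm] using this
  have hlim'' : Tendsto (fun l => ‖∫ x in G l, S (K + l) x ∂μ‖ + L / θ * (μ.restrict E).real Q)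
      atTop (𝓝 (L / θ * (μ.restrict E).real Q)) := by
    simpa using hlim'.norm.add_const (L / θ * (μ.restrict E).real Q)
  refine ge_of_tendsto' hlim'' fun l => (key l).trans ?_
  gcongr
  exact Set.sdiff_subset

end IsCellMartingale
end CellMartingale

section OneDim

lemma mseq_succ (p : ℕ → ℕ) (k : ℕ) : mseq p (k + 1) = mseq p k * p k :=
  Finset.prod_range_succ _ _

variable {p : ℕ → ℕ}

lemma mseq_pos (hp : ∀ i, 2 ≤ p i) (k : ℕ) : 0 < mseq p k :=
  Finset.prod_pos fun i _ => by have := hp i; omega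

lemma strictMono_mseq (hp : ∀ i, 2 ≤ p i) : StrictMono (mseq p) := by
  refine strictMono_nat_of_lt_succ fun k => ?_
  rw [mseq_succ]
  have := hp k
  have := mseq_pos hp k
  nlinarith

lemma hrank_eq (hp : ∀ i, 2 ≤ p i) {k n : ℕ} (h₁ : mseq p k ≤ n) (h₂ : n < mseq p (k + 1)) :
    hrank p n = k := by
  rw [hrank, Nat.findGreatest_eq_iff]
  refine ⟨((strictMono_mseq hp).id_le k).trans h₁, fun _ => h₁, fun l hl _ => ?_⟩
  exact not_le.mpr (h₂.trans_le ((strictMono_mseq hp).monotone hl))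

lemma exists_rank (hp : ∀ i, 2 ≤ p i) {n : ℕ} (hn : n ≠ 0) :
    ∃ k, mseq p k ≤ n ∧ n < mseq p (k + 1) := by
  refine ⟨hrank p n, ?_, ?_⟩
  · refine Nat.findGreatest_spec (P := fun k => mseq p k ≤ n) (Nat.zero_le n) ?_
    simpa [mseq] using Nat.one_le_iff_ne_zero.mpr hn
  · by_contra! h
    have h1 : hrank p n + 1 ≤ n := ((strictMono_mseq hp).id_le _).trans h
    have := Nat.le_findGreatest (P := fun k => mseq p k ≤ n) h1 h
    rw [← hrank] at this
    omega

/-- The index of the rank `k` half-open `P`-adic interval containing `x`. -/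
def cellIdx (p : ℕ → ℕ) (k : ℕ) (x : ℝ) : ℤ := ⌊x * (mseq p k : ℝ)⌋

lemma measurable_cellIdx (p : ℕ → ℕ) (k : ℕ) : Measurable (cellIdx p k) :=
  Int.measurable_floor.comp (measurable_id.mul_const _)

lemma cellIdx_eq_iff (hp : ∀ i, 2 ≤ p i) {k : ℕ} {i : ℤ} {x : ℝ} :
    cellIdx p k x = i ↔ (i : ℝ) / mseq p k ≤ x ∧ x < ((i : ℝ) + 1) / mseq p k := by
  have : (0 : ℝ) < mseq p k := by exact_mod_cast mseq_pos hp k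
  rw [cellIdx, Int.floor_eq_iff, div_le_iff₀ this, lt_div_iff₀ this]

lemma cellIdx_preimage (hp : ∀ i, 2 ≤ p i) (k : ℕ) (i : ℤ) :
    cellIdx p k ⁻¹' {i} = Set.Ico ((i : ℝ) / mseq p k) (((i : ℝ) + 1) / mseq p k) := by
  ext x
  exact cellIdx_eq_iff hp

lemma volume_cellIdx_preimage (hp : ∀ i, 2 ≤ p i) (k : ℕ) (i : ℤ) :
    volume (cellIdx p k ⁻¹' {i}) = ENNReal.ofReal (mseq p k : ℝ)⁻¹ := by
  rw [cellIdx_preimage hp, Real.volume_Ico]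
  congr 1
  ring

lemma cellIdx_div (hp : ∀ i, 2 ≤ p i) (k : ℕ) (x : ℝ) :
    cellIdx p (k + 1) x / (p k : ℤ) = cellIdx p k x := by
  have : (p k : ℝ) ≠ 0 := by have := hp k; positivity
  rw [cellIdx, ← Int.floor_div_natCast, mseq_succ, cellIdx]
  congr 1
  push_cast
  field_simp

lemma cellIdx_nested (hp : ∀ i, 2 ≤ p i) {k n : ℕ} (hkn : k ≤ n) {x y : ℝ}
    (h : cellIdx p n x = cellIdx p n y) : cellIdx p k x = cellIdx p k y := by
  induction n, hkn using Nat.le_induction with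
  | base => exact h
  | succ n _ ih =>
    apply ih
    rw [← cellIdx_div hp, h, cellIdx_div hp]

lemma pdigit_eq (k : ℕ) (x : ℝ) :
    pdigit p x k = (cellIdx p (k + 1) x % (p k : ℤ)).toNat := rfl

lemma ghaar_zero (x : ℝ) : ghaar p 0 x = 1 := by simp [ghaar]

lemma exists_ghaar_eq (hp : ∀ i, 2 ≤ p i) {k n : ℕ} (h₁ : mseq p k ≤ n)
    (h₂ : n < mseq p (k + 1)) :
    ∃ r s : ℕ, r < mseq p k ∧ 1 ≤ s ∧ s < p k ∧ n = mseq p k + r * (p k - 1) + (s - 1) ∧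
      ∀ x, ghaar p n x = if cellIdx p k x = r then
        (Real.sqrt (mseq p k) : ℂ) * eTwoPi ((pdigit p x k : ℝ) * (s : ℝ) / (p k : ℝ)) else 0 := by
  have hpk := hp k
  have hm := mseq_pos hp k
  refine ⟨(n - mseq p k) / (p k - 1), (n - mseq p k) % (p k - 1) + 1, ?_, by omega, ?_, ?_, ?_⟩
  · rw [Nat.div_lt_iff_lt_mul (by omega), Nat.mul_sub_one, ← mseq_succ]
    omega
  · have := Nat.mod_lt (n - mseq p k) (show 0 < p k - 1 by omega)
    omega
  · have := Nat.div_add_mod' (n - mseq p k) (p k - 1)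
    omega
  · intro x
    simp only [ghaar, hrank_eq hp h₁ h₂, if_neg (show n ≠ 0 by omega), cellIdx_eq_iff hp,
      Int.cast_natCast]

lemma ghaar_congr (hp : ∀ i, 2 ≤ p i) {n N : ℕ} (hn : n < mseq p N) {x y : ℝ}
    (h : cellIdx p N x = cellIdx p N y) : ghaar p n x = ghaar p n y := by
  rcases eq_or_ne n 0 with rfl | hn0
  · simp [ghaar_zero]
  obtain ⟨k, h₁, h₂⟩ := exists_rank hp hn0
  have hkN : k < N := (strictMono_mseq hp).lt_iff_lt.mp (h₁.trans_lt hn)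
  obtain ⟨r, s, -, -, -, -, hg⟩ := exists_ghaar_eq hp h₁ h₂
  rw [hg, hg, pdigit_eq, pdigit_eq, cellIdx_nested hp hkN h, cellIdx_nested hp hkN.le h]

lemma measurable_ghaar (hp : ∀ i, 2 ≤ p i) (n : ℕ) : Measurable (ghaar p n) :=
  measurable_of_eq_on_fibres (measurable_cellIdx p (n + 1)) fun _ _ =>
    ghaar_congr hp ((strictMono_mseq hp).id_le (n + 1))

lemma norm_eTwoPi (t : ℝ) : ‖eTwoPi t‖ = 1 := by
  rw [eTwoPi, show 2 * (Real.pi : ℂ) * Complex.I * (t : ℂ) = ((2 * Real.pi * t : ℝ) : ℂ) *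
    Complex.I by push_cast; ring, Complex.norm_exp_ofReal_mul_I]

lemma norm_ghaar_le (hp : ∀ i, 2 ≤ p i) (n : ℕ) (x : ℝ) :
    ‖ghaar p n x‖ ≤ Real.sqrt (mseq p (hrank p n)) := by
  have h1 : 1 ≤ Real.sqrt (mseq p (hrank p n)) := by
    rw [Real.one_le_sqrt]
    exact_mod_cast mseq_pos hp _
  rw [ghaar]
  split_ifs with h
  · simpa using h1
  · simp only
    split_ifs
    · rw [norm_mul, norm_eTwoPi, mul_one, Complex.norm_real, Real.norm_of_nonneg (by positivity)]
    · simp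

lemma sum_eTwoPi_eq_zero {q : ℕ} (hq : q ≠ 0) {s : ℤ} (hs : ¬ (q : ℤ) ∣ s) :
    ∑ t ∈ Finset.range q, eTwoPi ((t : ℝ) * (s : ℝ) / (q : ℝ)) = 0 := by
  set ζ : ℂ := Complex.exp (2 * Real.pi * Complex.I * (s / q)) with hζ
  have hq' : (q : ℂ) ≠ 0 := by exact_mod_cast hq
  have hpow : ∀ t : ℕ, eTwoPi ((t : ℝ) * (s : ℝ) / (q : ℝ)) = ζ ^ t := fun t => by
    rw [hζ, ← Complex.exp_nat_mul, eTwoPi]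
    congr 1
    push_cast
    ring
  have h1 : ζ ^ q = 1 := by
    rw [hζ, ← Complex.exp_nat_mul, Complex.exp_eq_one_iff]
    exact ⟨s, by field_simp⟩
  have hne : ζ ≠ 1 := by
    rw [hζ, Ne, Complex.exp_eq_one_iff]
    rintro ⟨n, hn⟩
    have h2 : (2 * Real.pi * Complex.I : ℂ) ≠ 0 := Complex.two_pi_I_ne_zero
    rw [mul_comm (n : ℂ)] at hn
    have h3 := mul_left_cancel₀ h2 hn
    rw [div_eq_iff hq'] at h3
    exact hs ⟨n, by rw [mul_comm]; exact_mod_cast h3⟩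
  simp_rw [hpow]
  have := geom_sum_mul ζ q
  rw [h1, sub_self] at this
  exact (mul_eq_zero.mp this).resolve_right (sub_ne_zero.mpr hne)

lemma cellIdx_preimage_eq_biUnion (hp : ∀ i, 2 ≤ p i) (k : ℕ) (i : ℤ) :
    cellIdx p k ⁻¹' {i} =
      ⋃ t ∈ Finset.range (p k), cellIdx p (k + 1) ⁻¹' {i * (p k : ℤ) + t} := by
  have hpk := hp k
  have hpos : (0 : ℤ) < p k := by omega
  ext x
  simp only [Set.mem_preimage, Set.mem_singleton_iff, Set.mem_iUnion, Finset.mem_range,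
    exists_prop, ← cellIdx_div hp k x]
  have h1 := Int.emod_add_mul_ediv (cellIdx p (k + 1) x) (p k)
  have h2 := Int.emod_nonneg (cellIdx p (k + 1) x) hpos.ne'
  have h3 := Int.emod_lt_of_pos (cellIdx p (k + 1) x) hpos
  constructor
  · rintro rfl
    refine ⟨(cellIdx p (k + 1) x % (p k : ℤ)).toNat, by omega, ?_⟩
    rw [Int.toNat_of_nonneg h2, mul_comm]
    omega
  · rintro ⟨t, ht, h⟩
    rw [h, add_comm, Int.add_mul_ediv_right _ _ hpos.ne', Int.ediv_eq_zero_of_lt (by omega)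
      (by omega), zero_add]

lemma setIntegral_eTwoPi_pdigit (hp : ∀ i, 2 ≤ p i) (k : ℕ) (i : ℤ) {s : ℤ}
    (hs : ¬ (p k : ℤ) ∣ s) :
    ∫ x in cellIdx p k ⁻¹' {i}, eTwoPi ((pdigit p x k : ℝ) * (s : ℝ) / (p k : ℝ)) = 0 := by
  have hpk := hp k
  have hmeas : ∀ i, MeasurableSet (cellIdx p (k + 1) ⁻¹' {i}) := fun i =>
    measurable_cellIdx p _ (measurableSet_singleton _)
  have hval : ∀ t ∈ Finset.range (p k), ∀ x ∈ cellIdx p (k + 1) ⁻¹' {i * (p k : ℤ) + t},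
      eTwoPi ((pdigit p x k : ℝ) * (s : ℝ) / (p k : ℝ)) =
        eTwoPi ((t : ℝ) * (s : ℝ) / (p k : ℝ)) := by
    intro t ht x hx
    rw [Finset.mem_range] at ht
    have : pdigit p x k = t := by
      rw [pdigit_eq, hx, Int.mul_add_emod_self_right, Int.emod_eq_of_lt (by omega) (by omega)]
      simp
    rw [this]
  have hvol : ∀ i, volume (cellIdx p (k + 1) ⁻¹' {i}) ≠ ⊤ := fun i => by
    rw [volume_cellIdx_preimage hp]
    exact ENNReal.ofReal_ne_top
  rw [cellIdx_preimage_eq_biUnion hp, integral_biUnion_finset _ (fun _ _ => hmeas _)]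
  · rw [Finset.sum_congr rfl fun t ht => setIntegral_congr_fun (hmeas _) (hval t ht)]
    simp_rw [setIntegral_const, Measure.real, volume_cellIdx_preimage hp, ← Finset.smul_sum]
    rw [sum_eTwoPi_eq_zero (by omega) hs, smul_zero]
  · intro t _ t' _ htt'
    refine Disjoint.preimage _ ?_
    simpa using htt'
  · exact fun t ht => (integrableOn_const (hvol _)).congr_fun (fun x hx => (hval t ht x hx).symm)
      (hmeas _)

lemma not_dvd_of_lt {q s : ℕ} (h₁ : 1 ≤ s) (h₂ : s < q) : ¬ (q : ℤ) ∣ s := by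
  rw [Int.natCast_dvd_natCast]
  exact Nat.not_dvd_of_pos_of_lt h₁ h₂

lemma setIntegral_ghaar_eq_zero (hp : ∀ i, 2 ≤ p i) {k n : ℕ} (h₁ : mseq p k ≤ n)
    (h₂ : n < mseq p (k + 1)) (i : ℤ) : ∫ x in cellIdx p k ⁻¹' {i}, ghaar p n x = 0 := by
  have hmeas : MeasurableSet (cellIdx p k ⁻¹' {i}) :=
    measurable_cellIdx p _ (measurableSet_singleton _)
  obtain ⟨r, s, -, hs₁, hs₂, -, hg⟩ := exists_ghaar_eq hp h₁ h₂
  by_cases hir : i = r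
  · rw [setIntegral_congr_fun hmeas (g := fun x => (Real.sqrt (mseq p k) : ℂ) *
      eTwoPi ((pdigit p x k : ℝ) * ((s : ℤ) : ℝ) / (p k : ℝ))), integral_const_mul,
      setIntegral_eTwoPi_pdigit hp k i (not_dvd_of_lt hs₁ hs₂), mul_zero]
    intro x hx
    have hx : cellIdx p k x = i := hx
    simp [hg, hx, hir]
  · rw [setIntegral_congr_fun hmeas (g := fun _ => 0), integral_zero]
    intro x hx
    have hx : cellIdx p k x = i := hx
    simp [hg, hx, hir]

/-- The inner product of generalized Haar functions over the unit interval. -/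
def haarInner (p : ℕ → ℕ) (n k : ℕ) : ℂ :=
  ∫ x in cellIdx p 0 ⁻¹' {0}, ghaar p n x * (starRingEnd ℂ) (ghaar p k x)

lemma integrableOn_ghaar_mul_conj (hp : ∀ i, 2 ≤ p i) (n k : ℕ) :
    IntegrableOn (fun x => ghaar p n x * (starRingEnd ℂ) (ghaar p k x))
      (cellIdx p 0 ⁻¹' {0}) := by
  refine Measure.integrableOn_of_bounded (M := Real.sqrt (mseq p (hrank p n)) *
    Real.sqrt (mseq p (hrank p k))) ?_ ?_ ?_
  · rw [volume_cellIdx_preimage hp]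
    exact ENNReal.ofReal_ne_top
  · exact ((measurable_ghaar hp n).mul
      (Complex.continuous_conj.measurable.comp (measurable_ghaar hp k))).aestronglyMeasurable
  · refine Eventually.of_forall fun x => ?_
    rw [norm_mul, RCLike.norm_conj]
    exact mul_le_mul (norm_ghaar_le hp n x) (norm_ghaar_le hp k x) (norm_nonneg _)
      (Real.sqrt_nonneg _)

lemma conj_eTwoPi (t : ℝ) : (starRingEnd ℂ) (eTwoPi t) = eTwoPi (-t) := by
  rw [eTwoPi, eTwoPi, ← Complex.exp_conj]
  congr 1
  simp [Complex.conj_ofReal, map_ofNat]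

lemma eTwoPi_add (s t : ℝ) : eTwoPi (s + t) = eTwoPi s * eTwoPi t := by
  rw [eTwoPi, eTwoPi, eTwoPi, ← Complex.exp_add]
  congr 1
  push_cast
  ring

lemma haarInner_eq_zero_of_lt (hp : ∀ i, 2 ≤ p i) {n k : ℕ} (hnk : n < k) :
    haarInner p n k = 0 := by
  obtain ⟨R, h₁, h₂⟩ := exists_rank hp (show k ≠ 0 by omega)
  rw [haarInner, setIntegral_congr_of_fibres (measurable_cellIdx p R) (g := fun _ => 0) ?_
    (integrableOn_ghaar_mul_conj hp n k) integrableOn_zero, integral_zero]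
  swap
  · exact fun x y hxy hx => (cellIdx_nested hp (Nat.zero_le R) hxy).symm.trans hx
  intro x₀ _
  rw [integral_zero]
  have hmeas : MeasurableSet (cellIdx p R ⁻¹' {cellIdx p R x₀}) :=
    measurable_cellIdx p _ (measurableSet_singleton _)
  rcases lt_or_ge n (mseq p R) with hn | hn
  · rw [setIntegral_congr_fun hmeas (g := fun x => ghaar p n x₀ *
      (starRingEnd ℂ) (ghaar p k x)), integral_const_mul, integral_conj,
      setIntegral_ghaar_eq_zero hp h₁ h₂]
    · simp
    · intro x hx
      simp only [ghaar_congr hp hn hx]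
  obtain ⟨r, s, -, hs₁, hs₂, hk, hgk⟩ := exists_ghaar_eq hp h₁ h₂
  obtain ⟨r', s', -, hs₁', hs₂', hn', hgn⟩ := exists_ghaar_eq hp hn (hnk.trans h₂)
  by_cases hr : cellIdx p R x₀ = r ∧ cellIdx p R x₀ = r'
  · obtain ⟨hr, hr'⟩ := hr
    have hrr : r = r' := by omega
    subst hrr
    have hss : s' < s := by omega
    rw [setIntegral_congr_fun hmeas (g := fun x => (Real.sqrt (mseq p R) : ℂ) ^ 2 *
      (starRingEnd ℂ) (eTwoPi ((pdigit p x R : ℝ) * (((s - s' : ℕ) : ℤ) : ℝ) / (p R : ℝ)))),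
      integral_const_mul, integral_conj,
      setIntegral_eTwoPi_pdigit hp R _ (not_dvd_of_lt (by omega) (by omega))]
    · simp
    · intro x hx
      have hx : cellIdx p R x = cellIdx p R x₀ := hx
      simp only [hgk, hgn, hx, hr, if_true, map_mul, Complex.conj_ofReal, conj_eTwoPi]
      have : eTwoPi (-((pdigit p x R : ℝ) * (((s - s' : ℕ) : ℤ) : ℝ) / (p R : ℝ))) =
          eTwoPi ((pdigit p x R : ℝ) * s' / p R) * eTwoPi (-((pdigit p x R : ℝ) * s / p R)) := by
        rw [← eTwoPi_add]
        congr 1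
        push_cast [Nat.cast_sub hss.le]
        ring
      rw [this]
      ring
  · rw [setIntegral_congr_fun hmeas (g := fun _ => 0), integral_zero]
    intro x hx
    have hx : cellIdx p R x = cellIdx p R x₀ := hx
    simp only [hgk, hgn, hx]
    rw [not_and_or] at hr
    rcases hr with hr | hr <;> simp [hr]

lemma haarInner_eq_zero (hp : ∀ i, 2 ≤ p i) {n k : ℕ} (hnk : n ≠ k) :
    haarInner p n k = 0 := by
  rcases lt_or_gt_of_ne hnk with h | h
  · exact haarInner_eq_zero_of_lt hp h
  · rw [← map_eq_zero (starRingEnd ℂ), haarInner, ← integral_conj,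
      ← haarInner_eq_zero_of_lt hp h, haarInner]
    simp [mul_comm]

lemma haarInner_self_ne_zero (hp : ∀ i, 2 ≤ p i) (n : ℕ) : haarInner p n n ≠ 0 := by
  rw [haarInner]
  have hvol : ∀ k i, volume.real (cellIdx p k ⁻¹' {i}) = (mseq p k : ℝ)⁻¹ := fun k i => by
    rw [Measure.real, volume_cellIdx_preimage hp, ENNReal.toReal_ofReal (by positivity)]
  rcases eq_or_ne n 0 with rfl | hn
  · simp [ghaar_zero, hvol, mseq]
  obtain ⟨k, h₁, h₂⟩ := exists_rank hp hn
  obtain ⟨r, s, hr, -, -, -, hg⟩ := exists_ghaar_eq hp h₁ h₂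
  have hm : (0 : ℝ) < mseq p k := by exact_mod_cast mseq_pos hp k
  have hsub : cellIdx p k ⁻¹' {(r : ℤ)} ⊆ cellIdx p 0 ⁻¹' {0} := by
    intro x hx
    have hx := (cellIdx_eq_iff hp).mp hx
    have h0 : (0 : ℝ) ≤ x := le_trans (by positivity) hx.1
    have h1 : x < 1 := hx.2.trans_le <| by
      rw [div_le_one hm]
      exact_mod_cast hr
    refine (cellIdx_eq_iff hp).mpr ?_
    simp [mseq, h0, h1]
  have heq : ∀ x, ghaar p n x * (starRingEnd ℂ) (ghaar p n x) =
      (cellIdx p k ⁻¹' {(r : ℤ)}).indicator (fun _ => ((mseq p k : ℝ) : ℂ)) x := by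
    intro x
    by_cases hx : cellIdx p k x = r
    · rw [Set.indicator_of_mem (show x ∈ cellIdx p k ⁻¹' {(r : ℤ)} from hx), Complex.mul_conj,
        Complex.normSq_eq_norm_sq, hg, if_pos hx, norm_mul, norm_eTwoPi, mul_one, Complex.norm_real, Real.norm_of_nonneg (by positivity),
        Real.sq_sqrt hm.le]
    · rw [Set.indicator_of_notMem (show x ∉ cellIdx p k ⁻¹' {(r : ℤ)} from hx), hg, if_neg hx, zero_mul]
  simp_rw [heq]
  rw [setIntegral_indicator (measurable_cellIdx p _ (measurableSet_singleton _)),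
    Set.inter_eq_right.mpr hsub, setIntegral_const, hvol, Complex.real_smul, ← Complex.ofReal_mul,
    inv_mul_cancel₀ hm.ne']
  simp

end OneDim

section MultiDim

variable {d : ℕ} {p : Fin d → ℕ → ℕ}

/-- The index of the rank `k` half-open `𝒫`-adic parallelepiped containing `x`. -/
def cellIdxD (p : Fin d → ℕ → ℕ) (k : ℕ) (x : Fin d → ℝ) : Fin d → ℤ :=
  fun j => cellIdx (p j) k (x j)

lemma measurable_cellIdxD (p : Fin d → ℕ → ℕ) (k : ℕ) : Measurable (cellIdxD p k) :=
  measurable_pi_lambda _ fun j => (measurable_cellIdx (p j) k).comp (measurable_pi_apply j)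

lemma cellIdxD_preimage_eq_pi (k : ℕ) (ν : Fin d → ℤ) :
    cellIdxD p k ⁻¹' {ν} = Set.univ.pi fun j => cellIdx (p j) k ⁻¹' {ν j} := by
  ext x
  simp [cellIdxD, funext_iff]

lemma volume_cellIdxD_preimage (hp : ∀ j i, 2 ≤ p j i) (k : ℕ) (ν : Fin d → ℤ) :
    volume (cellIdxD p k ⁻¹' {ν}) = ENNReal.ofReal (∏ j, (mseq (p j) k : ℝ)⁻¹) := by
  rw [cellIdxD_preimage_eq_pi, volume_pi_pi,
    ENNReal.ofReal_prod_of_nonneg fun j _ => by positivity]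
  exact Finset.prod_congr rfl fun j _ => volume_cellIdx_preimage (hp j) k (ν j)

lemma cellIdxD_preimage_subset_cell (hp : ∀ j i, 2 ≤ p j i) (k : ℕ) (ν : Fin d → ℤ) :
    cellIdxD p k ⁻¹' {ν} ⊆ cell p k ν := by
  rw [cellIdxD_preimage_eq_pi, cell]
  refine Set.pi_mono fun j _ => ?_
  rw [cellIdx_preimage (hp j)]
  exact Set.Ico_subset_Icc_self

lemma cellIdxD_preimage_ae_eq_cell (hp : ∀ j i, 2 ≤ p j i) (k : ℕ) (ν : Fin d → ℤ) :
    (cellIdxD p k ⁻¹' {ν} : Set (Fin d → ℝ)) =ᵐ[volume] cell p k ν := by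
  rw [cellIdxD_preimage_eq_pi, cell]
  simp_rw [cellIdx_preimage (hp _)]
  exact Measure.pi_Ico_ae_eq_pi_Icc

lemma interior_cell_ae_eq (k : ℕ) (ν : Fin d → ℤ) :
    (interior (cell p k ν) : Set (Fin d → ℝ)) =ᵐ[volume] cell p k ν := by
  rw [cell, interior_pi_set Set.finite_univ]
  simp_rw [interior_Icc]
  exact Measure.pi_Ioo_ae_eq_pi_Icc

lemma measurable_ghaarD (hp : ∀ j i, 2 ≤ p j i) (n : Fin d → ℕ) : Measurable (ghaarD p n) :=
  Finset.measurable_prod _ fun j _ => (measurable_ghaar (hp j) (n j)).comp (measurable_pi_apply j)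

lemma norm_ghaarD_le (hp : ∀ j i, 2 ≤ p j i) (n : Fin d → ℕ) (x : Fin d → ℝ) :
    ‖ghaarD p n x‖ ≤ ghaarNormD p n := by
  rw [ghaarD, norm_prod]
  exact Finset.prod_le_prod (fun _ _ => norm_nonneg _) fun j _ => norm_ghaar_le (hp j) _ _

lemma integrableOn_ghaarD (hp : ∀ j i, 2 ≤ p j i) (n : Fin d → ℕ) (k : ℕ) (ν : Fin d → ℤ) :
    IntegrableOn (ghaarD p n) (cellIdxD p k ⁻¹' {ν}) := by
  refine Measure.integrableOn_of_bounded ?_ (measurable_ghaarD hp n).aestronglyMeasurable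
    (Eventually.of_forall (norm_ghaarD_le hp n))
  rw [volume_cellIdxD_preimage hp]
  exact ENNReal.ofReal_ne_top

lemma measurable_ghaarSum (hp : ∀ j i, 2 ≤ p j i) (a : (Fin d → ℕ) → ℂ) (N : ℕ) :
    Measurable (ghaarSum p a N) :=
  Finset.measurable_sum _ fun n _ => (measurable_ghaarD hp n).const_mul (a n)

lemma setIntegral_cell_prod (k : ℕ) (ν : Fin d → ℤ) (f : Fin d → ℝ → ℂ) :
    ∫ x in cellIdxD p k ⁻¹' {ν}, ∏ j, f j (x j) =
      ∏ j, ∫ x in cellIdx (p j) k ⁻¹' {ν j}, f j x := by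
  rw [cellIdxD_preimage_eq_pi, volume_pi, Measure.restrict_pi_pi, integral_fintype_prod_eq_prod]

lemma isCellMartingale_ghaarSum (hp : ∀ j i, 2 ≤ p j i) (a : (Fin d → ℕ) → ℂ) :
    IsCellMartingale volume (cellIdxD p) (ghaarSum p a) where
  measurable := measurable_cellIdxD p
  measure_ne_top n i := by
    rw [volume_cellIdxD_preimage hp]
    exact ENNReal.ofReal_ne_top
  nested n x y h := funext fun j => cellIdx_nested (hp j) n.le_succ (congr_fun h j)
  const n x y h := by
    refine Finset.sum_congr rfl fun k hk => ?_
    congr 1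
    refine Finset.prod_congr rfl fun j _ => ?_
    simp only [Fintype.mem_piFinset, Finset.mem_range] at hk
    exact ghaar_congr (hp j) (hk j) (congr_fun h j)
  integrableOn n k i :=
    integrable_finsetSum _ fun m _ => (integrableOn_ghaarD hp m k i).const_mul (a m)
  setIntegral_succ N i := by
    have hint : ∀ n, IntegrableOn (fun x => a n * ghaarD p n x) (cellIdxD p N ⁻¹' {i}) :=
      fun n => (integrableOn_ghaarD hp n N i).const_mul (a n)
    simp only [ghaarSum]
    rw [integral_finsetSum _ fun n _ => hint n, integral_finsetSum _ fun n _ => hint n]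
    symm
    refine Finset.sum_subset (Fintype.piFinset_subset _ _ fun j =>
      Finset.range_subset_range.mpr ((strictMono_mseq (hp j)).monotone N.le_succ)) ?_
    intro n hn hn'
    simp only [Fintype.mem_piFinset, Finset.mem_range, not_forall, not_lt] at hn hn'
    obtain ⟨j, hj⟩ := hn'
    rw [integral_const_mul]
    simp only [ghaarD]
    rw [setIntegral_cell_prod N i fun j => ghaar (p j) (n j), Finset.prod_eq_zero
      (Finset.mem_univ j) (setIntegral_ghaar_eq_zero (hp j) hj (hn j) _), mul_zero]

lemma coeff_eq_zero (hp : ∀ j i, 2 ≤ p j i) {a : (Fin d → ℕ) → ℂ}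
    (h : ∀ N x, cellIdxD p 0 x = 0 → ghaarSum p a N x = 0) (k : Fin d → ℕ) : a k = 0 := by
  set N := ∑ j, k j + 1 with hN
  have hk : k ∈ Fintype.piFinset fun j => Finset.range (mseq (p j) N) := by
    simp only [Fintype.mem_piFinset, Finset.mem_range]
    intro j
    have h1 := Finset.single_le_sum (f := k) (fun _ _ => Nat.zero_le _) (Finset.mem_univ j)
    have h2 := (strictMono_mseq (hp j)).id_le N
    simp only [id] at h2
    omega
  have hint : ∀ n, ∫ x in cellIdxD p 0 ⁻¹' {0}, ghaarD p n x * (starRingEnd ℂ) (ghaarD p k x) =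
      ∏ j, haarInner (p j) (n j) (k j) := fun n => by
    simp only [ghaarD, map_prod, ← Finset.prod_mul_distrib]
    exact setIntegral_cell_prod 0 0
      fun j x => ghaar (p j) (n j) x * (starRingEnd ℂ) (ghaar (p j) (k j) x)
  have hzero : ∫ x in cellIdxD p 0 ⁻¹' {0},
      ghaarSum p a N x * (starRingEnd ℂ) (ghaarD p k x) = 0 := by
    rw [setIntegral_congr_fun (measurable_cellIdxD p 0 (measurableSet_singleton _))
      (g := fun _ => 0), integral_zero]
    intro x hx
    simp only [h N x hx, zero_mul]
  simp only [ghaarSum, Finset.sum_mul, mul_assoc] at hzero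
  rw [integral_finsetSum] at hzero
  · simp_rw [integral_const_mul, hint] at hzero
    rw [Finset.sum_eq_single_of_mem k hk] at hzero
    · refine (mul_eq_zero.mp hzero).resolve_right ?_
      exact Finset.prod_ne_zero_iff.mpr fun j _ => haarInner_self_ne_zero (hp j) _
    · intro n _ hnk
      obtain ⟨j, hj⟩ := Function.ne_iff.mp hnk
      rw [Finset.prod_eq_zero (Finset.mem_univ j) (haarInner_eq_zero (hp j) hj), mul_zero]
  · intro n _
    refine Integrable.const_mul ?_ _
    refine (integrableOn_ghaarD hp n 0 0).mul_bdd (c := ghaarNormD p k) ?_ ?_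
    · exact (Complex.continuous_conj.measurable.comp (measurable_ghaarD hp k)).aestronglyMeasurable
    · refine Eventually.of_forall fun x => ?_
      simpa only [RCLike.norm_conj] using norm_ghaarD_le hp k x

lemma cellIdxD_regular (hp : ∀ j i, 2 ≤ p j i) {M : ℕ} (hM : ∀ j i, p j i ≤ M) (n : ℕ)
    (ν ν' : Fin d → ℤ) :
    ENNReal.ofReal ((M : ℝ) ^ d + 1)⁻¹ * volume (cellIdxD p n ⁻¹' {ν}) <
      volume (cellIdxD p (n + 1) ⁻¹' {ν'}) := by
  rw [volume_cellIdxD_preimage hp, volume_cellIdxD_preimage hp,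
    ← ENNReal.ofReal_mul (by positivity)]
  have hpos : ∀ j k, (0 : ℝ) < mseq (p j) k := fun j k => by exact_mod_cast mseq_pos (hp j) k
  have hppos : ∀ j, (0 : ℝ) < p j n := fun j => by
    have := hp j n
    positivity
  have hV : (0 : ℝ) < ∏ j, (mseq (p j) n : ℝ)⁻¹ :=
    Finset.prod_pos fun j _ => inv_pos.mpr (hpos j n)
  have hP : ∏ j, (p j n : ℝ) ≤ (M : ℝ) ^ d := by
    simpa using Finset.prod_le_prod (s := Finset.univ) (f := fun j => (p j n : ℝ))
      (g := fun _ => (M : ℝ)) (fun j _ => (hppos j).le) fun j _ => by exact_mod_cast hM j n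
  have hP0 : (0 : ℝ) < ∏ j, (p j n : ℝ) := Finset.prod_pos fun j _ => hppos j
  have heq : ∏ j, (mseq (p j) (n + 1) : ℝ)⁻¹ =
      (∏ j, (p j n : ℝ))⁻¹ * ∏ j, (mseq (p j) n : ℝ)⁻¹ := by
    rw [← Finset.prod_inv_distrib, ← Finset.prod_mul_distrib]
    refine Finset.prod_congr rfl fun j _ => ?_
    rw [mseq_succ]
    push_cast
    rw [mul_inv, mul_comm]
  rw [heq, ENNReal.ofReal_lt_ofReal_iff (by positivity)]
  refine mul_lt_mul_of_pos_right ?_ hV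
  exact inv_strictAnti₀ hP0 (by linarith)

/-- The `h`-weighted bound for the mean of `S_k` over a cell on which `h` is nearly constant. -/
lemma norm_setIntegral_ghaarSum_le (hp : ∀ j i, 2 ≤ p j i) {M : ℕ} (hM : ∀ j i, p j i ≤ M)
    {a : (Fin d → ℕ) → ℂ}
    (hconv : ∀ᵐ x ∂(volume.restrict (Set.Icc (0 : Fin d → ℝ) 1)),
      Tendsto (fun N => ghaarSum p a N x) atTop (𝓝 0))
    {h : (Fin d → ℝ) → ℝ} (h0 : ∀ x ∈ Set.Icc (0 : Fin d → ℝ) 1, 0 ≤ h x)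
    (hint : IntegrableOn h (Set.Icc (0 : Fin d → ℝ) 1)) {E : Set (Fin d → ℝ)}
    (hE : NullMeasurableSet E) (hEsub : E ⊆ Set.Icc 0 1)
    (hbound : ∀ x ∈ Set.Icc (0 : Fin d → ℝ) 1, x ∉ E → ∀ N, ‖ghaarSum p a N x‖ ≤ h x)
    {k : ℕ} {ν : Fin d → ℤ} (hQ : cellIdxD p k ⁻¹' {ν} ⊆ Set.Icc 0 1)
    {C ε : ℝ} (hC : 0 < C) (hε : 0 < ε)
    (hCh : ∀ x ∈ cellIdxD p k ⁻¹' {ν}, ∀ y ∈ cellIdxD p k ⁻¹' {ν}, h x ≤ C * h y)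
    (hεQ : ε ≤ ∫ x in cellIdxD p k ⁻¹' {ν}, h x)
    (hsmall : ∫ x in E, h x ≤ ((M : ℝ) ^ d + 1)⁻¹ * ε / C) :
    ‖∫ x in cellIdxD p k ⁻¹' {ν}, ghaarSum p a k x‖ ≤
      C ^ 2 * ((M : ℝ) ^ d + 1) * ∫ x in E ∩ cellIdxD p k ⁻¹' {ν}, h x := by
  set θ : ℝ := ((M : ℝ) ^ d + 1)⁻¹ with hθdef
  have hθ : 0 < θ := by positivity
  have hS := isCellMartingale_ghaarSum hp a
  set Q := cellIdxD p k ⁻¹' {ν} with hQdef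
  have hmQ : MeasurableSet Q := measurable_cellIdxD p k (measurableSet_singleton _)
  have hQtop : volume Q ≠ ⊤ := hS.measure_ne_top k ν
  have hEQ : NullMeasurableSet (E ∩ Q) := hE.inter hmQ.nullMeasurableSet
  have hEQtop : volume (E ∩ Q) ≠ ⊤ := measure_ne_top_of_subset Set.inter_subset_right hQtop
  obtain ⟨y₀, hy₀⟩ : Q.Nonempty := by
    by_contra hne
    rw [Set.not_nonempty_iff_eq_empty.mp hne] at hεQ
    simp at hεQ
    linarith
  have hQpos : 0 < volume.real Q := by
    rw [Measure.real, hQdef, volume_cellIdxD_preimage hp, ENNReal.toReal_ofReal (by positivity)]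
    exact Finset.prod_pos fun j _ => inv_pos.mpr (by exact_mod_cast mseq_pos (hp j) k)
  have hconst : ∀ b : ℝ, (∀ x ∈ Q, b ≤ h x) → volume.real (E ∩ Q) * b ≤ ∫ x in E ∩ Q, h x := by
    intro b hb
    rw [← smul_eq_mul, ← setIntegral_const]
    refine integral_mono_ae (integrableOn_const hEQtop)
      (hint.mono_set fun x hx => hEsub hx.1) ?_
    filter_upwards [ae_restrict_mem₀ hEQ] with x hx using hb x hx.2
  have hlow : ∀ y ∈ Q, ε / (C * volume.real Q) ≤ h y := by
    intro y hy
    have h1 : ∫ x in Q, h x ≤ ∫ _x in Q, C * h y :=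
      setIntegral_mono_on (hint.mono_set hQ) (integrableOn_const hQtop) hmQ
        fun x hx => hCh x hx y hy
    rw [setIntegral_const, smul_eq_mul] at h1
    rw [div_le_iff₀ (by positivity)]
    linarith
  have hEQle : ∫ x in E ∩ Q, h x ≤ ∫ x in E, h x := by
    refine setIntegral_mono_set (hint.mono_set hEsub) ?_
      (Filter.Eventually.of_forall fun x hx => hx.1)
    filter_upwards [ae_restrict_mem₀ hE] with x hx using h0 x (hEsub hx)
  have hgood : volume.restrict E Q ≤ ENNReal.ofReal θ * volume Q := by
    rw [Measure.restrict_apply hmQ, Set.inter_comm, ← ENNReal.ofReal_toReal hEQtop,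
      ← ENNReal.ofReal_toReal hQtop, ← ENNReal.ofReal_mul hθ.le]
    refine ENNReal.ofReal_le_ofReal ?_
    have h1 := ((hconst _ hlow).trans hEQle).trans hsmall
    have h2 : volume.real (E ∩ Q) * (ε / C) ≤ θ * volume.real Q * (ε / C) := by
      calc _ = volume.real (E ∩ Q) * (ε / (C * volume.real Q)) * volume.real Q := by
            field_simp
        _ ≤ θ * ε / C * volume.real Q := by gcongr
        _ = _ := by ring
    exact le_of_mul_le_mul_right h2 (by positivity)
  have hCy₀ : 0 ≤ C * h y₀ := mul_nonneg hC.le (h0 _ (hQ hy₀))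
  have hmain := hS.norm_setIntegral_le hθ (fun n x => cellIdxD_regular hp hM n _ _) hCy₀
    (K := k) (i := ν) (E := E)
    (fun x hx hxE n => (hbound x (hQ hx) hxE n).trans (hCh x hx y₀ hy₀)) hgood
    (ae_restrict_of_ae_restrict_of_subset hQ hconv)
  refine hmain.trans ?_
  have h1 : volume.real (E ∩ Q) * (h y₀ / C) ≤ ∫ x in E ∩ Q, h x :=
    hconst _ fun x hx => by
      rw [div_le_iff₀ hC, mul_comm]
      exact hCh y₀ hy₀ x hx
  have h2 : (volume.restrict E).real Q = volume.real (E ∩ Q) := by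
    rw [Measure.real, Measure.restrict_apply hmQ, Set.inter_comm, Measure.real]
  rw [h2]
  calc C * h y₀ / θ * volume.real (E ∩ Q)
      = C ^ 2 * ((M : ℝ) ^ d + 1) * (volume.real (E ∩ Q) * (h y₀ / C)) := by
        rw [hθdef, div_inv_eq_mul]
        field_simp
    _ ≤ _ := by gcongr

end MultiDim

section Main

variable {d : ℕ} {p : Fin d → ℕ → ℕ}

lemma cellIdxD_zero_preimage_subset (hp : ∀ j i, 2 ≤ p j i) :
    cellIdxD p 0 ⁻¹' {0} ⊆ Set.Icc (0 : Fin d → ℝ) 1 := by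
  refine (cellIdxD_preimage_subset_cell hp 0 0).trans ?_
  rw [cell, ← Set.pi_univ_Icc]
  simp [mseq]

lemma nullMeasurableSet_exceptional (hp : ∀ j i, 2 ≤ p j i) (a : (Fin d → ℕ) → ℂ)
    {I : Set (Fin d → ℝ)} (hI : MeasurableSet I) {h : (Fin d → ℝ) → ℝ} (hint : IntegrableOn h I) :
    NullMeasurableSet {x ∈ I | ∃ N, h x < ‖ghaarSum p a N x‖} := by
  have h1 : NullMeasurableSet {x | ∃ N, h x < ‖ghaarSum p a N x‖} (volume.restrict I) := by
    rw [Set.ofPred_exists]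
    exact .iUnion fun N => nullMeasurableSet_lt hint.aestronglyMeasurable.aemeasurable
      (measurable_ghaarSum hp a N).norm.aemeasurable
  rw [nullMeasurableSet_restrict hI.nullMeasurableSet] at h1
  rwa [Set.inter_comm] at h1

/-- Intersecting two half-open cells leaves nothing or the smaller one. -/
lemma cellIdxD_preimage_inter (hp : ∀ j i, 2 ≤ p j i) {k n : ℕ} (hkn : k ≤ n) (ν μ : Fin d → ℤ)
    (hne : (cellIdxD p k ⁻¹' {ν} ∩ cellIdxD p n ⁻¹' {μ}).Nonempty) :
    cellIdxD p n ⁻¹' {μ} ⊆ cellIdxD p k ⁻¹' {ν} := by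
  obtain ⟨x, hx, hx'⟩ := hne
  intro y hy
  have hyx : cellIdxD p n y = cellIdxD p n x := hy.trans hx'.symm
  exact ((isCellMartingale_ghaarSum hp 0).nested_le hkn hyx).trans hx

/-- The mean of `S_K` over a rank `K` cell is controlled by a single `h` as in (h2)–(h3). -/
lemma norm_setIntegral_ghaarSum_le_of_cover (hp : ∀ j i, 2 ≤ p j i) {M : ℕ}
    (hM : ∀ j i, p j i ≤ M) {a : (Fin d → ℕ) → ℂ}
    (hconv : ∀ᵐ x ∂(volume.restrict (Set.Icc (0 : Fin d → ℝ) 1)),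
      Tendsto (fun N => ghaarSum p a N x) atTop (𝓝 0))
    {h : (Fin d → ℝ) → ℝ} (h0 : ∀ x ∈ Set.Icc (0 : Fin d → ℝ) 1, 0 ≤ h x)
    (hint : IntegrableOn h (Set.Icc (0 : Fin d → ℝ) 1))
    {C ε : ℝ} (hC : 0 < C) (hε : 0 < ε) {s : ℕ} {J : Fin s → Set (Fin d → ℝ)}
    (hJ : ∀ i, J i ∈ Lambda p)
    (hdisj : ∀ i j, i ≠ j → Disjoint (interior (J i)) (interior (J j)))
    (hU : (⋃ i, J i) = Set.Icc 0 1) (hCh : ∀ i, ∀ x ∈ J i, ∀ y ∈ J i, h x ≤ C * h y)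
    (hεJ : ∀ i, ε ≤ ∫ x in J i, h x)
    (hsmall : ∫ x in {x ∈ Set.Icc (0 : Fin d → ℝ) 1 | ∃ N, h x < ‖ghaarSum p a N x‖}, h x ≤
      ((M : ℝ) ^ d + 1)⁻¹ * ε / C)
    {K : ℕ} {ν : Fin d → ℤ} (hQ : cellIdxD p K ⁻¹' {ν} ⊆ Set.Icc 0 1)
    (hεQ : ε ≤ ∫ x in cellIdxD p K ⁻¹' {ν}, h x) :
    ‖∫ x in cellIdxD p K ⁻¹' {ν}, ghaarSum p a K x‖ ≤ C ^ 2 * ((M : ℝ) ^ d + 1) *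
      ∫ x in {x ∈ Set.Icc (0 : Fin d → ℝ) 1 | ∃ N, h x < ‖ghaarSum p a N x‖}, h x := by
  set E := {x ∈ Set.Icc (0 : Fin d → ℝ) 1 | ∃ N, h x < ‖ghaarSum p a N x‖} with hEdef
  have hE : NullMeasurableSet E := nullMeasurableSet_exceptional hp a measurableSet_Icc hint
  have hEsub : E ⊆ Set.Icc 0 1 := fun x hx => hx.1
  have hbound : ∀ x ∈ Set.Icc (0 : Fin d → ℝ) 1, x ∉ E → ∀ N, ‖ghaarSum p a N x‖ ≤ h x := by
    intro x hx hxE N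
    by_contra! hlt
    exact hxE ⟨hx, N, hlt⟩
  have hS := isCellMartingale_ghaarSum hp a
  choose k μ hkμ using hJ
  set Q := cellIdxD p K ⁻¹' {ν} with hQdef
  set H : Fin s → Set (Fin d → ℝ) := fun i => cellIdxD p (k i) ⁻¹' {μ i} with hHdef
  have hHJ : ∀ i, H i ⊆ J i := fun i => hkμ i ▸ cellIdxD_preimage_subset_cell hp _ _
  have hHJae : ∀ i, (H i : Set (Fin d → ℝ)) =ᵐ[volume] J i := fun i => by
    rw [hkμ i]
    exact cellIdxD_preimage_ae_eq_cell hp _ _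
  have hJsub : ∀ i, J i ⊆ Set.Icc 0 1 := fun i => hU ▸ Set.subset_iUnion J i
  have hmQ : MeasurableSet Q := measurable_cellIdxD p K (measurableSet_singleton _)
  have hmH : ∀ i, MeasurableSet (H i) := fun i =>
    measurable_cellIdxD p (k i) (measurableSet_singleton _)
  have hHdisj : Pairwise (Function.onFun (AEDisjoint volume) H) := by
    intro i j hij
    refine AEDisjoint.congr (hdisj i j hij).aedisjoint ?_ ?_
    · exact (hHJae i).trans (by rw [hkμ i]; exact (interior_cell_ae_eq _ _).symm)
    · exact (hHJae j).trans (by rw [hkμ j]; exact (interior_cell_ae_eq _ _).symm)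
  have hWdisj : Pairwise (Function.onFun (AEDisjoint volume) fun i => Q ∩ H i) :=
    fun i j hij => (hHdisj hij).mono Set.inter_subset_right Set.inter_subset_right
  have hQae : (Q : Set (Fin d → ℝ)) =ᵐ[volume] ⋃ i, Q ∩ H i := by
    rw [← Set.inter_iUnion]
    have h1 : (⋃ i, H i : Set (Fin d → ℝ)) =ᵐ[volume] ⋃ i, J i :=
      Filter.EventuallyEq.countable_iUnion hHJae
    have h2 := (EventuallyEq.refl (ae volume) Q).inter h1
    rw [hU, Set.inter_eq_left.mpr hQ] at h2
    exact h2.symm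
  obtain ⟨N, hKN, hkN⟩ : ∃ N, K ≤ N ∧ ∀ i, k i ≤ N :=
    ⟨K + ∑ i, k i, by omega, fun i => (Finset.single_le_sum (f := k) (fun _ _ => Nat.zero_le _)
      (Finset.mem_univ i)).trans (by omega)⟩
  have hpiece : ∀ i, ‖∫ x in Q ∩ H i, ghaarSum p a N x‖ ≤
      C ^ 2 * ((M : ℝ) ^ d + 1) * ∫ x in E ∩ (Q ∩ H i), h x := by
    intro i
    rcases (Q ∩ H i).eq_empty_or_nonempty with he | hne
    · simp [he]
    rcases le_total (k i) K with hk | hk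
    · have hsub : Q ⊆ H i := cellIdxD_preimage_inter hp hk _ _ (by rwa [Set.inter_comm])
      rw [Set.inter_eq_left.mpr hsub, hQdef, hS.setIntegral_eq hKN]
      exact norm_setIntegral_ghaarSum_le hp hM hconv h0 hint hE hEsub hbound hQ hC hε
        (fun x hx y hy => hCh i x (hHJ i (hsub hx)) y (hHJ i (hsub hy))) hεQ hsmall
    · have hsub : H i ⊆ Q := cellIdxD_preimage_inter hp hk _ _ hne
      rw [Set.inter_eq_right.mpr hsub]
      simp only [hHdef]
      rw [hS.setIntegral_eq (hkN i)]
      exact norm_setIntegral_ghaarSum_le hp hM hconv h0 hint hE hEsub hbound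
        ((hHJ i).trans (hJsub i)) hC hε (fun x hx y hy => hCh i x (hHJ i hx) y (hHJ i hy))
        ((hεJ i).trans_eq (setIntegral_congr_set (hHJae i)).symm) hsmall
  have hsum : ∑ i, ∫ x in E ∩ (Q ∩ H i), h x ≤ ∫ x in E, h x := by
    have hsub : ⋃ i, E ∩ (Q ∩ H i) ⊆ E := Set.iUnion_subset fun i => Set.inter_subset_left
    rw [← tsum_fintype (L := .unconditional _), ← integral_iUnion_ae]
    · refine setIntegral_mono_set (hint.mono_set hEsub) ?_ (Eventually.of_forall hsub)
      filter_upwards [ae_restrict_mem₀ hE] with x hx using h0 x (hEsub hx)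
    · exact fun i => hE.inter (hmQ.inter (hmH i)).nullMeasurableSet
    · exact fun i j hij => (hWdisj hij).mono Set.inter_subset_right Set.inter_subset_right
    · exact hint.mono_set (hsub.trans hEsub)
  calc ‖∫ x in Q, ghaarSum p a K x‖ = ‖∫ x in Q, ghaarSum p a N x‖ := by
        rw [hQdef, hS.setIntegral_eq hKN]
    _ = ‖∑ i, ∫ x in Q ∩ H i, ghaarSum p a N x‖ := by
        rw [setIntegral_congr_set hQae, integral_iUnion_ae
          (fun i => (hmQ.inter (hmH i)).nullMeasurableSet) hWdisj, tsum_fintype]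
        exact (hS.integrableOn N K ν).mono_set (Set.iUnion_subset fun i => Set.inter_subset_left)
    _ ≤ ∑ i, C ^ 2 * ((M : ℝ) ^ d + 1) * ∫ x in E ∩ (Q ∩ H i), h x :=
        (norm_sum_le _ _).trans (Finset.sum_le_sum fun i _ => hpiece i)
    _ ≤ _ := by
        rw [← Finset.mul_sum]
        gcongr

lemma eventually_le_setIntegral {X : Type*} [MeasurableSpace X] {μ : Measure X} {Q : Set X}
    (hQ : MeasurableSet Q) (hμ : μ Q ≠ 0) {h : ℕ → X → ℝ} (h0 : ∀ m, ∀ x ∈ Q, 0 ≤ h m x)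
    (hint : ∀ m, IntegrableOn (h m) Q μ) (hmono : ∀ x ∈ Q, Monotone fun m => h m x)
    (htop : ∀ x ∈ Q, Tendsto (fun m => h m x) atTop atTop) (ε : ℝ) :
    ∀ᶠ m in atTop, ε ≤ ∫ x in Q, h m x ∂μ := by
  have h1 : Tendsto (fun m => ∫⁻ x in Q, ENNReal.ofReal (h m x) ∂μ) atTop
      (𝓝 (∫⁻ _x in Q, ⊤ ∂μ)) := by
    refine lintegral_tendsto_of_tendsto_of_monotone
      (fun m => (hint m).aestronglyMeasurable.aemeasurable.ennreal_ofReal) ?_ ?_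
    · filter_upwards [ae_restrict_mem hQ] with x hx i j hij
      exact ENNReal.ofReal_le_ofReal (hmono x hx hij)
    · filter_upwards [ae_restrict_mem hQ] with x hx
      exact ENNReal.tendsto_ofReal_atTop.comp (htop x hx)
  rw [setLIntegral_const, ENNReal.top_mul hμ] at h1
  filter_upwards [h1.eventually (lt_mem_nhds (ENNReal.ofReal_lt_top (r := ε)))] with m hm
  have h2 : 0 ≤ᵐ[μ.restrict Q] h m := by
    filter_upwards [ae_restrict_mem hQ] with x hx using h0 m x hx
  rw [← ofReal_integral_eq_lintegral_ofReal (hint m) h2] at hm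
  exact (ENNReal.ofReal_lt_ofReal_iff'.mp hm).1.le

end Main

/-- **Uniqueness theorem for multiple generalized Haar series.**  If the `𝒫`-adic partial
sums `S_N = ∑_{n̄ < Ñ} a_{n̄} χ^𝒫_{n̄}` converge to `0` a.e. on `[0,1]ᵈ`, with
`sup_{i,j} pʲᵢ ≤ M < ∞`, and there is a sequence `{h m}` satisfying (h1)–(h3) on
`[0,1]ᵈ` with `∫_{{x : sup_N |S_N(x)| > h m x}} h m → 0`, then all coefficients vanish. -/
theorem uniqueness_generalized_haar
    (d : ℕ) (p : Fin d → ℕ → ℕ) (hp : ∀ j i, 2 ≤ p j i)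
    (M : ℕ) (hM : ∀ j i, p j i ≤ M)
    (a : (Fin d → ℕ) → ℂ)
    (hconv : ∀ᵐ x ∂(volume.restrict (Set.Icc (0 : Fin d → ℝ) 1)),
      Tendsto (fun N => ghaarSum p a N x) atTop (𝓝 0))
    (h : ℕ → (Fin d → ℝ) → ℝ) (hh : HConds p (Set.Icc (0 : Fin d → ℝ) 1) h)
    (hsmall : Tendsto (fun m =>
        ∫ x in {x ∈ Set.Icc (0 : Fin d → ℝ) 1 | ∃ N, h m x < ‖ghaarSum p a N x‖},
          h m x)
      atTop (𝓝 0)) :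
    ∀ n : Fin d → ℕ, a n = 0 := by
  obtain ⟨hpt, C, hC, ε, hε, hcover⟩ := hh
  have hint : ∀ m, IntegrableOn (h m) (Set.Icc (0 : Fin d → ℝ) 1) := by
    intro m
    obtain ⟨s, J, -, -, hU, -, hεJ⟩ := hcover m
    rw [← hU, integrableOn_finite_iUnion]
    intro i
    by_contra hni
    have := hεJ i
    rw [integral_undef hni] at this
    linarith
  have hS := isCellMartingale_ghaarSum hp a
  refine coeff_eq_zero hp fun K x₀ hx₀ => ?_
  set Q := cellIdxD p K ⁻¹' {cellIdxD p K x₀} with hQdef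
  have hmQ : MeasurableSet Q := measurable_cellIdxD p K (measurableSet_singleton _)
  have hQ : Q ⊆ Set.Icc 0 1 := fun x hx =>
    cellIdxD_zero_preimage_subset hp ((hS.nested_le (Nat.zero_le K) hx).trans hx₀)
  have hQpos : 0 < volume.real Q := by
    rw [Measure.real, hQdef, volume_cellIdxD_preimage hp, ENNReal.toReal_ofReal (by positivity)]
    exact Finset.prod_pos fun j _ => inv_pos.mpr (by exact_mod_cast mseq_pos (hp j) K)
  have hlarge : ∀ᶠ m in atTop, ε ≤ ∫ x in Q, h m x :=
    eventually_le_setIntegral hmQ (fun h0 => by simp [Measure.real, h0] at hQpos)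
      (fun m x hx => (hpt x (hQ hx)).1 m) (fun m => (hint m).mono_set hQ)
      (fun x hx => (hpt x (hQ hx)).2.1) (fun x hx => (hpt x (hQ hx)).2.2) ε
  have hη : (0 : ℝ) < ((M : ℝ) ^ d + 1)⁻¹ * ε / C := by positivity
  have hle : ‖∫ x in Q, ghaarSum p a K x‖ ≤ 0 := by
    have hlim := hsmall.const_mul (C ^ 2 * ((M : ℝ) ^ d + 1))
    rw [mul_zero] at hlim
    refine ge_of_tendsto hlim ?_
    filter_upwards [hlarge, hsmall.eventually (ge_mem_nhds hη)] with m hm hm'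
    obtain ⟨s, J, hJ, hdisj, hU, hCh, hεJ⟩ := hcover m
    exact norm_setIntegral_ghaarSum_le_of_cover hp hM hconv (fun x hx => (hpt x hx).1 m) (hint m)
      hC hε hJ hdisj hU hCh hεJ hm' hQ hm
  rw [setIntegral_congr_fun hmQ (g := fun _ => ghaarSum p a K x₀)
    (fun x hx => hS.const K x x₀ hx), setIntegral_const] at hle
  exact (smul_eq_zero.mp (norm_le_zero_iff.mp hle)).resolve_left hQpos.ne'
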